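/- arXiv:2104.03029 — 3 statements merged into one kernel-verified Lean document; each statement's English description precedes it below -/
import Mathlib

section
/- Let k be a perfect field of characteristic p > 0, let A be a regular local ring essentially of finite type over k, and let f ∈ A be a nonzero element such that R = A/(f) is regular. Let F be the fraction field of A and set I = (f), so I^n = (f^n). Then for every r ≥ 1 and every n ≥ 1 one has K̂^M_r(A|I^{n+1}) ⊆ E_r(A, I^n) as subgroups of K^M_r(F); moreover E_r(A,I) = K̂^M_r(A|I). -/
noncomputable section

namespace MilnorKTheory

/-- The tensor algebra `T_*(A^×)` over `ℤ` of the unit group of `A` (written additively). -/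
abbrev PreK (A : Type*) [CommRing A] : Type _ := TensorAlgebra ℤ (Additive Aˣ)

/-- The element `a₁ ⊗ ⋯ ⊗ a_r` of the tensor algebra `T_*(A^×)`. -/
def preSymbol {A : Type*} [CommRing A] : List Aˣ → PreK A
  | [] => 1
  | a :: l => TensorAlgebra.ι ℤ (Additive.ofMul a) * preSymbol l

/-- The relation cutting out Kato's Milnor ring: kill every homogeneous element
`a₁ ⊗ ⋯ ⊗ a_s` with `s ≥ 2` such that `a_i + a_j = 1` for some `i ≠ j`. -/
def katoRel (A : Type*) [CommRing A] : PreK A → PreK A → Prop := fun x y =>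
  y = 0 ∧ ∃ l : List Aˣ, 2 ≤ l.length ∧
    (∃ i j : ℕ, ∃ hi : i < l.length, ∃ hj : j < l.length,
      i ≠ j ∧ ((l[i]'hi : A) + (l[j]'hj : A) = 1)) ∧
    x = preSymbol l

/-- The relation cutting out the weak Milnor ring: kill the degree-2 elements
`a₁ ⊗ a₂` with `a₁ + a₂ = 1`. -/
def tildeRel (A : Type*) [CommRing A] : PreK A → PreK A → Prop := fun x y =>
  y = 0 ∧ ∃ a b : Aˣ, ((a : A) + (b : A) = 1) ∧ x = preSymbol [a, b]

/-- The (graded) quotient `T_*(A^×)/(Kato's Steinberg ideal)`, whose degree-`r` part is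
Kato's Milnor K-group `K^M_r(A)`. -/
abbrev KRing (A : Type*) [CommRing A] : Type _ := RingQuot (katoRel A)

/-- The (graded) quotient `T_*(A^×)/(a ⊗ b : a + b = 1)`, whose degree-`r` part is the group
`K̃^M_r(A)`. -/
abbrev TRing (A : Type*) [CommRing A] : Type _ := RingQuot (tildeRel A)

/-- The Milnor symbol `{a₁, …, a_r}` in Kato's Milnor ring. -/
def ksymbol {A : Type*} [CommRing A] (l : List Aˣ) : KRing A :=
  RingQuot.mkRingHom _ (preSymbol l)

/-- The Milnor symbol `{a₁, …, a_r}` in the weak Milnor ring. -/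
def tsymbol {A : Type*} [CommRing A] (l : List Aˣ) : TRing A :=
  RingQuot.mkRingHom _ (preSymbol l)

section maps

variable {A B : Type*} [CommRing A] [CommRing B]

/-- The map of tensor algebras induced by a ring homomorphism `A →+* B` via the induced map of
unit groups. -/
def preMap (φ : A →+* B) : PreK A →ₐ[ℤ] PreK B :=
  TensorAlgebra.lift ℤ ((TensorAlgebra.ι ℤ).comp
    ((MonoidHom.toAdditive (Units.map (φ : A →* B))).toIntLinearMap))

lemma preMap_preSymbol (φ : A →+* B) (l : List Aˣ) :
    preMap φ (preSymbol l) = preSymbol (l.map (Units.map (φ : A →* B))) := by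
  induction l with
  | nil => simp [preSymbol]
  | cons a l ih =>
      simp only [preSymbol, map_mul, ih, List.map_cons]
      congr 1
      exact TensorAlgebra.lift_ι_apply _ _

/-- Functoriality of Kato's Milnor ring. -/
def kmap (φ : A →+* B) : KRing A →+* KRing B :=
  RingQuot.lift ⟨(RingQuot.mkRingHom (katoRel B)).comp (preMap φ).toRingHom, by
    rintro x y ⟨rfl, l, hlen, ⟨i, j, hi, hj, hij, hsum⟩, rfl⟩
    simp only [RingHom.comp_apply, map_zero, AlgHom.toRingHom_eq_coe, RingHom.coe_coe]
    rw [preMap_preSymbol]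
    refine (RingQuot.mkRingHom_rel ?_).trans (map_zero _)
    refine ⟨rfl, l.map (Units.map (φ : A →* B)), by simpa using hlen,
      ⟨i, j, by simpa using hi, by simpa using hj, hij, ?_⟩, rfl⟩
    simp only [List.getElem_map]
    show φ _ + φ _ = 1
    rw [← map_add, hsum, map_one]⟩

/-- Functoriality of the weak Milnor ring. -/
def tmap (φ : A →+* B) : TRing A →+* TRing B :=
  RingQuot.lift ⟨(RingQuot.mkRingHom (tildeRel B)).comp (preMap φ).toRingHom, by
    rintro x y ⟨rfl, a, b, hsum, rfl⟩
    simp only [RingHom.comp_apply, map_zero, AlgHom.toRingHom_eq_coe, RingHom.coe_coe]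
    rw [preMap_preSymbol]
    refine (RingQuot.mkRingHom_rel ?_).trans (map_zero _)
    refine ⟨rfl, Units.map (φ : A →* B) a, Units.map (φ : A →* B) b, ?_, rfl⟩
    show φ _ + φ _ = 1
    rw [← map_add, hsum, map_one]⟩

/-- The canonical map `K̃^M_*(A) → K^M_*(A)`. -/
def tToK (A : Type*) [CommRing A] : TRing A →+* KRing A :=
  RingQuot.lift ⟨RingQuot.mkRingHom (katoRel A), by
    rintro x y ⟨rfl, a, b, hsum, rfl⟩
    rw [map_zero]
    refine (RingQuot.mkRingHom_rel ?_).trans (map_zero _)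
    exact ⟨rfl, [a, b], by norm_num,
      ⟨0, 1, by norm_num, by norm_num, by norm_num, by simpa using hsum⟩, rfl⟩⟩

end maps

section groups

variable (A : Type*) [CommRing A]

/-- The Milnor K-group `K^M_r(A)`: the degree-`r` part of Kato's Milnor ring, i.e. the
additive subgroup generated by the Milnor symbols of length `r`. -/
def KGroup (r : ℕ) : AddSubgroup (KRing A) :=
  AddSubgroup.closure { x | ∃ l : List Aˣ, l.length = r ∧ x = ksymbol l }

/-- The group `K̃^M_r(A)`: the degree-`r` part of the weak Milnor ring. -/
def TGroup (r : ℕ) : AddSubgroup (TRing A) :=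
  AddSubgroup.closure { x | ∃ l : List Aˣ, l.length = r ∧ x = tsymbol l }

/-- The relative Milnor K-group `K^M_r(A, I)`: the kernel of
`K^M_r(A) → K^M_r(A/I)`. -/
def relKGroup (I : Ideal A) (r : ℕ) : AddSubgroup (KRing A) :=
  KGroup A r ⊓ AddMonoidHom.ker (kmap (Ideal.Quotient.mk I)).toAddMonoidHom

/-- The relative group `K̃^M_r(A, I)`: the kernel of `K̃^M_r(A) → K̃^M_r(A/I)`. -/
def relTGroup (I : Ideal A) (r : ℕ) : AddSubgroup (TRing A) :=
  TGroup A r ⊓ AddMonoidHom.ker (tmap (Ideal.Quotient.mk I)).toAddMonoidHom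

end groups

end MilnorKTheory

end

namespace MilnorKTheory

section fraction

variable (A : Type*) [CommRing A] [IsDomain A]

/-- The localization `A_g = A[1/g]`, realized as the subring of the fraction field `F` of `A`
generated by (the image of) `A` together with `1/g`. -/
def awaySubring (g : A) : Subring (FractionRing A) :=
  Subring.closure
    (Set.range (algebraMap A (FractionRing A)) ∪ {(algebraMap A (FractionRing A) g)⁻¹})

/-- The predicate on a unit `v` of the fraction field `F` of `A` saying that `v` is in the image
of `(A_g)^× → F^×`, i.e. both `v` and `v⁻¹` lie in the subring `A_g ⊆ F`. -/
def memAwayUnits (g : A) (v : (FractionRing A)ˣ) : Prop :=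
  ((v : FractionRing A) ∈ awaySubring A g) ∧
    (((v⁻¹ : (FractionRing A)ˣ) : FractionRing A) ∈ awaySubring A g)

/-- The subgroup `K̂^M_r(A|J) ⊆ K^M_r(F)` (for `J` and the localization at `g`): the image of
the product map `K^M_1(A,J) ⊗ (A_g)^× ⊗ ⋯ ⊗ (A_g)^× → K^M_r(F)` (with `r - 1` factors
`(A_g)^×`), i.e. the additive subgroup generated by the Milnor symbols `{u, v₂, …, v_r}` with
`u ∈ ker(A^× → (A/J)^×)` and `v₂, …, v_r ∈ (A_g)^×`. -/
def hatKGroup (g : A) (J : Ideal A) (r : ℕ) : AddSubgroup (KRing (FractionRing A)) :=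
  AddSubgroup.closure
    { x | ∃ u : Aˣ, ((u : A) - 1 ∈ J) ∧ ∃ v : List (FractionRing A)ˣ,
        v.length = r - 1 ∧ (∀ w ∈ v, memAwayUnits A g w) ∧
        x = ksymbol ((Units.map ((algebraMap A (FractionRing A)) : A →* FractionRing A) u) :: v) }

/-- The subgroup `E_r(A,J) ⊆ K^M_r(F)`: the image of the canonical map
`K^M_r(A,J) → K^M_r(F)`. -/
def eGroup (J : Ideal A) (r : ℕ) : AddSubgroup (KRing (FractionRing A)) :=
  AddSubgroup.map (kmap (algebraMap A (FractionRing A))).toAddMonoidHom (relKGroup A J r)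

end fraction

end MilnorKTheory

/-- A commutative ring is a regular local ring if it is Noetherian local and its maximal ideal
can be generated by (Krull dimension)-many elements. -/
def IsRegularLocal (R : Type*) [CommRing R] : Prop :=
  IsNoetherianRing R ∧ ∃ h : IsLocalRing R, ∃ s : Finset R,
    Ideal.span (s : Set R) = @IsLocalRing.maximalIdeal R _ h ∧
    ((s.card : ℕ∞) : WithBot ℕ∞) = ringKrullDim R

/-- In a local ring whose maximal ideal is generated by the finite set `s`, an element of the
maximal ideal outside its square can replace one of the generators. -/
lemma IsLocalRing.exists_span_insert_erase_of_notMem_sq {R : Type*} [CommRing R] [IsLocalRing R]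
    [DecidableEq R] {s : Finset R} (hs : Ideal.span (s : Set R) = IsLocalRing.maximalIdeal R)
    {x : R} (hx : x ∈ IsLocalRing.maximalIdeal R) (hx2 : x ∉ IsLocalRing.maximalIdeal R ^ 2) :
    ∃ y ∈ s, Ideal.span (insert x (s.erase y : Set R)) = IsLocalRing.maximalIdeal R := by
  obtain ⟨c, hc⟩ := Submodule.mem_span_finset'.1 (show x ∈ Ideal.span (s : Set R) from hs ▸ hx)
  have hmem : ∀ a ∈ s, a ∈ IsLocalRing.maximalIdeal R := fun a ha =>
    hs ▸ Ideal.subset_span (Finset.mem_coe.2 ha)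
  obtain ⟨y, hy⟩ : ∃ y : s, IsUnit (c y) := by
    by_contra! h
    refine hx2 (hc ▸ Ideal.sum_mem _ fun a _ => ?_)
    rw [smul_eq_mul, pow_two]
    exact Ideal.mul_mem_mul ((IsLocalRing.mem_maximalIdeal _).2 (h a)) (hmem a a.2)
  refine ⟨y, y.2, le_antisymm ?_ ?_⟩
  · rw [Ideal.span_le]
    rintro a (rfl | ha)
    · exact hx
    · exact hmem a (Finset.mem_of_mem_erase (Finset.mem_coe.1 ha))
  · rw [← hs, Ideal.span_le]
    intro a ha
    by_cases hay : a = y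
    · subst hay
      obtain ⟨u, hu⟩ := hy
      have hsum : c y * (y : R) = x - ∑ b ∈ Finset.univ.erase y, c b • (b : R) := by
        rw [← hc, ← Finset.add_sum_erase _ _ (Finset.mem_univ y), smul_eq_mul]
        ring
      have : (y : R) = ↑u⁻¹ * (x - ∑ b ∈ Finset.univ.erase y, c b • (b : R)) := by
        rw [← hsum, ← hu, ← mul_assoc, Units.inv_mul, one_mul]
      have hmem' : ↑u⁻¹ * (x - ∑ b ∈ Finset.univ.erase y, c b • (b : R)) ∈
          Ideal.span (insert x (s.erase (y : R) : Set R)) := by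
        refine Ideal.mul_mem_left _ _ (Ideal.sub_mem _ (Ideal.subset_span (Or.inl rfl))
          (Ideal.sum_mem _ fun b hb => Ideal.mul_mem_left _ _ (Ideal.subset_span (Or.inr ?_))))
        exact Finset.mem_coe.2 (Finset.mem_erase.2
          ⟨fun h => (Finset.mem_erase.1 hb).1 (Subtype.ext h), b.2⟩)
      rwa [← this] at hmem'
    · exact Ideal.subset_span (Or.inr (Finset.mem_coe.2 (Finset.mem_erase.2 ⟨hay, ha⟩)))

/-- If the maximal ideal of a local ring is contained in a minimal prime, then the Krull
dimension is zero. -/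
lemma IsLocalRing.ringKrullDim_eq_zero_of_maximalIdeal_le {R : Type*} [CommRing R] [IsLocalRing R]
    {P : Ideal R} (hP : P ∈ minimalPrimes R) (h : IsLocalRing.maximalIdeal R ≤ P) :
    ringKrullDim R = 0 := by
  refine ringKrullDimZero_iff_ringKrullDim_eq_zero.1 (Ring.KrullDimLE.mk₀ fun I hI => ?_)
  have : I = IsLocalRing.maximalIdeal R := by
    refine le_antisymm (IsLocalRing.le_maximalIdeal hI.ne_top) (h.trans ?_)
    exact hP.2 ⟨hI, bot_le⟩ ((IsLocalRing.le_maximalIdeal hI.ne_top).trans h)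
  exact this ▸ IsLocalRing.maximalIdeal.isMaximal R

/-- In a Noetherian local ring of positive dimension there is an element of the maximal ideal
lying neither in its square nor in any minimal prime. -/
lemma IsLocalRing.exists_mem_maximalIdeal_notMem_sq_notMem_minimalPrimes {R : Type*} [CommRing R]
    [IsLocalRing R] [IsNoetherianRing R] (hR : ringKrullDim R ≠ 0) :
    ∃ x ∈ IsLocalRing.maximalIdeal R, x ∉ IsLocalRing.maximalIdeal R ^ 2 ∧
      ∀ P ∈ minimalPrimes R, x ∉ P := by
  by_contra! h
  have hsub : (IsLocalRing.maximalIdeal R : Set R) ⊆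
      ⋃ I ∈ insert (IsLocalRing.maximalIdeal R ^ 2) (minimalPrimes R), ((id I : Ideal R) : Set R) := by
    intro x hx
    simp only [Set.mem_iUnion]
    by_cases hx2 : x ∈ IsLocalRing.maximalIdeal R ^ 2
    · exact ⟨_, Or.inl rfl, hx2⟩
    · obtain ⟨P, hP, hxP⟩ := h x hx hx2
      exact ⟨P, Or.inr hP, hxP⟩
  obtain ⟨I, hI, hle⟩ := (Ideal.subset_union_prime_finite
    ((minimalPrimes.finite_of_isNoetherianRing R).insert _) (IsLocalRing.maximalIdeal R ^ 2)
    (IsLocalRing.maximalIdeal R ^ 2) (by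
      rintro I (rfl | hI) h1 -
      · exact absurd rfl h1
      · exact hI.1.1)).1 hsub
  rcases hI with rfl | hI
  · have hbot : IsLocalRing.maximalIdeal R = ⊥ := by
      refine Submodule.eq_bot_of_le_smul_of_le_jacobson_bot (IsLocalRing.maximalIdeal R) _
        (IsNoetherian.noetherian _) ?_ (IsLocalRing.maximalIdeal_le_jacobson _)
      rwa [id, pow_two] at hle
    obtain ⟨P, hP, -⟩ := Ideal.exists_minimalPrimes_le (bot_le : ⊥ ≤ IsLocalRing.maximalIdeal R)
    exact hR (ringKrullDim_eq_zero_of_maximalIdeal_le hP (hbot ▸ bot_le))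
  · exact hR (ringKrullDim_eq_zero_of_maximalIdeal_le hI hle)

/-- A Noetherian local ring with a principal prime ideal in the maximal ideal, whose generator
avoids all minimal primes, is a domain. -/
lemma IsLocalRing.isDomain_of_isPrime_span_singleton {R : Type*} [CommRing R]
    [IsLocalRing R] [IsNoetherianRing R] {x : R} (hx : x ∈ IsLocalRing.maximalIdeal R)
    (hxP : ∀ P ∈ minimalPrimes R, x ∉ P) (hprime : (Ideal.span {x}).IsPrime) : IsDomain R := by
  obtain ⟨P, hP, hPx⟩ := Ideal.exists_minimalPrimes_le (bot_le : ⊥ ≤ Ideal.span {x})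
  have hPprime : P.IsPrime := hP.1.1
  have hbot : P = ⊥ := by
    refine Submodule.eq_bot_of_le_smul_of_le_jacobson_bot (IsLocalRing.maximalIdeal R) _
      (IsNoetherian.noetherian _) (fun y hy => ?_) (IsLocalRing.maximalIdeal_le_jacobson _)
    obtain ⟨z, rfl⟩ := Ideal.mem_span_singleton.1 (hPx hy)
    exact Submodule.smul_mem_smul hx ((hPprime.mem_or_mem hy).resolve_left (hxP P hP))
  subst hbot
  exact IsDomain.of_bot_isPrime R

/-- A Noetherian local ring whose maximal ideal is generated by at most dimension many elements
is a domain. -/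
lemma IsLocalRing.isDomain_of_card_le_ringKrullDim {R : Type*} [CommRing R]
    [IsLocalRing R] [IsNoetherianRing R] (s : Finset R)
    (hs : Ideal.span (s : Set R) = IsLocalRing.maximalIdeal R) {n : ℕ} (hn : s.card ≤ n)
    (hdim : (n : WithBot ℕ∞) ≤ ringKrullDim R) : IsDomain R := by
  classical
  induction n generalizing R with
  | zero =>
    obtain rfl := Finset.card_eq_zero.1 (Nat.le_zero.1 hn)
    rw [Finset.coe_empty, Ideal.span_empty] at hs
    have : (⊥ : Ideal R).IsPrime := hs ▸ (IsLocalRing.maximalIdeal.isMaximal R).isPrime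
    exact IsDomain.of_bot_isPrime R
  | succ n ih =>
    have h0 : ringKrullDim R ≠ 0 := by
      intro h
      rw [h] at hdim
      norm_cast at hdim
    obtain ⟨x, hx, hx2, hxP⟩ :=
      exists_mem_maximalIdeal_notMem_sq_notMem_minimalPrimes h0
    obtain ⟨y, hy, hspan⟩ := exists_span_insert_erase_of_notMem_sq hs hx hx2
    have hne : Ideal.span {x} ≠ ⊤ := fun h =>
      (IsLocalRing.maximalIdeal.isMaximal R).ne_top
        (top_le_iff.1 (h ▸ (Ideal.span_singleton_le_iff_mem _).2 hx))
    have : Nontrivial (R ⧸ Ideal.span {x}) := Ideal.Quotient.nontrivial_iff.2 hne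
    have hsurj : Function.Surjective (Ideal.Quotient.mk (Ideal.span {x})) :=
      Ideal.Quotient.mk_surjective
    have : IsLocalRing (R ⧸ Ideal.span {x}) := IsLocalRing.of_surjective' _ hsurj
    refine isDomain_of_isPrime_span_singleton hx hxP
      ((Ideal.Quotient.isDomain_iff_prime _).1 ?_)
    have hcardle : ((s.erase y).image (Ideal.Quotient.mk (Ideal.span {x}))).card ≤ n :=
      Finset.card_image_le.trans (by rw [Finset.card_erase_of_mem hy]; omega)
    have hgen : Ideal.span (((s.erase y).image (Ideal.Quotient.mk (Ideal.span {x})) :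
        Finset (R ⧸ Ideal.span {x})) : Set (R ⧸ Ideal.span {x})) =
        IsLocalRing.maximalIdeal (R ⧸ Ideal.span {x}) := by
      have : Ideal.map (Ideal.Quotient.mk (Ideal.span {x})) (IsLocalRing.maximalIdeal R) =
          IsLocalRing.maximalIdeal (R ⧸ Ideal.span {x}) := by
        exact map_maximalIdeal_of_surjective _ hsurj
      rw [← this, ← hspan, Ideal.map_span, Set.image_insert_eq,
        Ideal.Quotient.eq_zero_iff_mem.2 (Ideal.mem_span_singleton_self x), Ideal.span_insert_zero,
        Finset.coe_image]
    have hdim' : (n : WithBot ℕ∞) ≤ ringKrullDim (R ⧸ Ideal.span {x}) := by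
      have h1 := ringKrullDim_le_ringKrullDim_quotient_add_card ({x} : Finset R) (by
        simpa [← IsLocalRing.ringJacobson_eq_maximalIdeal] using hx)
      rw [Finset.coe_singleton, Finset.card_singleton] at h1
      have h2 := hdim.trans h1
      push_cast at h2
      exact ENat.WithBot.add_le_add_one_right_iff.1 h2
    exact ih _ hgen hcardle hdim'

/-- A regular local ring is a domain. -/
lemma IsRegularLocal.isDomain {R : Type*} [CommRing R] (hR : IsRegularLocal R) : IsDomain R := by
  obtain ⟨_, _, s, hs, hdim⟩ := hR
  exact IsLocalRing.isDomain_of_card_le_ringKrullDim s hs le_rfl hdim.le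
namespace MilnorKTheory

section symbols

variable {A : Type*} [CommRing A]

lemma kring_neg_mul (x y : KRing A) : -x * y = -(x * y) := neg_mul x y

lemma kring_mul_neg (x y : KRing A) : x * -y = -(x * y) := mul_neg x y

lemma kring_zsmul_mul (n : ℤ) (x y : KRing A) : n • x * y = n • (x * y) := smul_mul_assoc n x y

lemma ksymbol_nil : ksymbol ([] : List Aˣ) = 1 := by
  simp [ksymbol, preSymbol]

lemma ksymbol_cons (a : Aˣ) (l : List Aˣ) : ksymbol (a :: l) = ksymbol [a] * ksymbol l := by
  simp [ksymbol, preSymbol]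

lemma ksymbol_append (l l' : List Aˣ) : ksymbol (l ++ l') = ksymbol l * ksymbol l' := by
  induction l with
  | nil => rw [List.nil_append, ksymbol_nil, one_mul]
  | cons a l ih => rw [List.cons_append, ksymbol_cons, ih, ksymbol_cons a l, mul_assoc]

/-- The additive homomorphism `a ↦ {a}` from the unit group to the Milnor ring. -/
noncomputable def ksymbolHom (A : Type*) [CommRing A] : Additive Aˣ →+ KRing A :=
  (RingQuot.mkRingHom (katoRel A)).toAddMonoidHom.comp
    (TensorAlgebra.ι ℤ (M := Additive Aˣ)).toAddMonoidHom

lemma ksymbolHom_ofMul (a : Aˣ) : ksymbolHom A (Additive.ofMul a) = ksymbol [a] := by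
  simp [ksymbolHom, ksymbol, preSymbol]

lemma ksymbol_one : ksymbol [(1 : Aˣ)] = 0 := by
  rw [← ksymbolHom_ofMul, ofMul_one, map_zero]

lemma ksymbol_mul (a b : Aˣ) : ksymbol [a * b] = ksymbol [a] + ksymbol [b] := by
  simp only [← ksymbolHom_ofMul, ofMul_mul, map_add]

lemma ksymbol_inv (a : Aˣ) : ksymbol [a⁻¹] = -ksymbol [a] := by
  simp only [← ksymbolHom_ofMul, ofMul_inv, map_neg]

lemma ksymbol_div (a b : Aˣ) : ksymbol [a / b] = ksymbol [a] - ksymbol [b] := by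
  simp only [← ksymbolHom_ofMul, ofMul_div, map_sub]

lemma ksymbol_zpow (a : Aˣ) (m : ℤ) : ksymbol [a ^ m] = m • ksymbol [a] := by
  simp only [← ksymbolHom_ofMul, ofMul_zpow, map_zsmul]

lemma ksymbol_eq_zero_of_getElem_add_getElem (l : List Aˣ) (i j : ℕ) (hi : i < l.length)
    (hj : j < l.length) (hij : i ≠ j) (h : (l[i] : A) + (l[j] : A) = 1) : ksymbol l = 0 :=
  (RingQuot.mkRingHom_rel ⟨rfl, l, by omega, ⟨i, j, hi, hj, hij, h⟩, rfl⟩).trans (map_zero _)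

lemma ksymbol_mul_ksymbol_of_add_eq_one {a b : Aˣ} (h : (a : A) + b = 1) :
    ksymbol [a] * ksymbol [b] = 0 := by
  rw [← ksymbol_cons]
  exact ksymbol_eq_zero_of_getElem_add_getElem [a, b] 0 1 (by simp) (by simp) (by simp) h

lemma kmap_ksymbol {B : Type*} [CommRing B] (φ : A →+* B) (l : List Aˣ) :
    kmap φ (ksymbol l) = ksymbol (l.map (Units.map (φ : A →* B))) := by
  rw [kmap, ksymbol, RingQuot.lift_mkRingHom_apply]
  simp [ksymbol, preMap_preSymbol]

lemma closure_range_ksymbol :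
    AddSubgroup.closure (Set.range (ksymbol (A := A))) = ⊤ := by
  set S := AddSubgroup.closure (Set.range (ksymbol (A := A)))
  have hmul : ∀ x ∈ S, ∀ y ∈ S, x * y ∈ S := by
    intro x hx y hy
    induction hx, hy using AddSubgroup.closure_induction₂ with
    | mem x y hx hy =>
      obtain ⟨l, rfl⟩ := hx
      obtain ⟨l', rfl⟩ := hy
      rw [← ksymbol_append]
      exact AddSubgroup.subset_closure ⟨_, rfl⟩
    | zero_left x hx => rw [zero_mul]; exact S.zero_mem
    | zero_right x hx => rw [mul_zero]; exact S.zero_mem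
    | add_left x y z _ _ _ h1 h2 => rw [add_mul]; exact S.add_mem h1 h2
    | add_right x y z _ _ _ h1 h2 => rw [mul_add]; exact S.add_mem h1 h2
    | neg_left x y _ _ h => rw [kring_neg_mul]; exact S.neg_mem h
    | neg_right x y _ _ h => rw [kring_mul_neg]; exact S.neg_mem h
  refine (AddSubgroup.eq_top_iff' _).2 fun x => ?_
  obtain ⟨x, rfl⟩ := RingQuot.mkRingHom_surjective _ x
  induction x using TensorAlgebra.induction with
  | algebraMap n =>
    rw [eq_intCast, map_intCast, ← zsmul_one]
    exact S.zsmul_mem (AddSubgroup.subset_closure ⟨[], ksymbol_nil⟩) n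
  | ι a =>
    exact AddSubgroup.subset_closure ⟨[a.toMul], by simp [ksymbol, preSymbol]⟩
  | mul x y hx hy => rw [map_mul]; exact hmul _ hx _ hy
  | add x y hx hy => rw [map_add]; exact S.add_mem hx hy

end symbols

section grading

variable (A : Type*) [CommRing A]

variable {A} in
/-- An additive homomorphism from the unit group to a ring which satisfies the Steinberg relations
extends to the Milnor ring. -/
noncomputable def liftKRing {Q : Type*} [Ring Q] (g : Additive Aˣ →+ Q)
    (hg : ∀ (l : List Aˣ) (i j : ℕ) (hi : i < l.length) (hj : j < l.length), i ≠ j →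
      (l[i] : A) + (l[j] : A) = 1 → (l.map fun a => g (Additive.ofMul a)).prod = 0) :
    KRing A →+* Q :=
  RingQuot.lift ⟨(TensorAlgebra.lift ℤ g.toIntLinearMap).toRingHom, by
    have key : ∀ l : List Aˣ, TensorAlgebra.lift ℤ g.toIntLinearMap (preSymbol l) =
        (l.map fun a => g (Additive.ofMul a)).prod := by
      intro l
      induction l with
      | nil => simp [preSymbol]
      | cons a l ih => simp [preSymbol, ih]
    rintro x y ⟨rfl, l, -, ⟨i, j, hi, hj, hij, hsum⟩, rfl⟩
    exact ((key l).trans (hg l i j hi hj hij hsum)).trans (map_zero _).symm⟩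

variable {A} in
lemma liftKRing_ksymbol {Q : Type*} [Ring Q] (g : Additive Aˣ →+ Q)
    (hg : ∀ (l : List Aˣ) (i j : ℕ) (hi : i < l.length) (hj : j < l.length), i ≠ j →
      (l[i] : A) + (l[j] : A) = 1 → (l.map fun a => g (Additive.ofMul a)).prod = 0)
    (l : List Aˣ) :
    liftKRing g hg (ksymbol l) = (l.map fun a => g (Additive.ofMul a)).prod := by
  induction l with
  | nil => rw [ksymbol_nil, map_one]; rfl
  | cons a l ih =>
    rw [ksymbol_cons, map_mul, ih, List.map_cons, List.prod_cons]
    congr 1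
    rw [liftKRing, ksymbol, RingQuot.lift_mkRingHom_apply]
    simp [preSymbol]

open Polynomial in
/-- The additive homomorphism `a ↦ {a} X` to polynomials over the Milnor ring. -/
noncomputable def monomialHom : Additive Aˣ →+ (KRing A)[X] :=
  (monomial 1).toAddMonoidHom.comp (ksymbolHom A)

open Polynomial in
lemma prod_map_monomialHom (l : List Aˣ) :
    (l.map fun a => monomialHom A (Additive.ofMul a)).prod = monomial l.length (ksymbol l) := by
  induction l with
  | nil => rw [ksymbol_nil]; rfl
  | cons a l ih =>
    rw [List.map_cons, List.prod_cons, ih, ksymbol_cons, ← ksymbolHom_ofMul, List.length_cons,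
      add_comm]
    exact monomial_mul_monomial 1 l.length _ _

open Polynomial in
/-- The projection of the Milnor ring onto its degree `r` part. -/
noncomputable def degreePart (r : ℕ) : KRing A →+ KRing A :=
  (lcoeff (KRing A) r).toAddMonoidHom.comp (liftKRing (monomialHom A) (by
    intro l i j hi hj hij hsum
    rw [prod_map_monomialHom, ksymbol_eq_zero_of_getElem_add_getElem l i j hi hj hij hsum,
      map_zero])).toAddMonoidHom

open Polynomial in
lemma degreePart_ksymbol (r : ℕ) (l : List Aˣ) :
    degreePart A r (ksymbol l) = if l.length = r then ksymbol l else 0 := by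
  have : degreePart A r (ksymbol l) = (monomial l.length (ksymbol l)).coeff r := by
    rw [← prod_map_monomialHom]
    exact congrArg (fun q => coeff q r) (liftKRing_ksymbol _ _ l)
  rw [this, coeff_monomial]

lemma degreePart_eq_self {r : ℕ} {x : KRing A} (hx : x ∈ KGroup A r) : degreePart A r x = x := by
  induction hx using AddSubgroup.closure_induction with
  | mem x hx =>
    obtain ⟨l, hl, rfl⟩ := hx
    rw [degreePart_ksymbol, if_pos hl]
  | zero => exact map_zero _
  | add x y _ _ hx hy => rw [map_add, hx, hy]
  | neg x _ hx => rw [map_neg, hx]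

end grading

section field

variable {F : Type*} [Field F]

lemma ksymbol_mul_ksymbol_neg (a : Fˣ) : ksymbol [a] * ksymbol [-a] = 0 := by
  by_cases ha : a = 1
  · rw [ha, ksymbol_one, zero_mul]
  have ha' : (a : F) ≠ 1 := fun h => ha (Units.ext h)
  have h0 : (a : F) ≠ 0 := a.ne_zero
  let b : Fˣ := Units.mk0 (1 - a) (sub_ne_zero.2 ha'.symm)
  let c : Fˣ := Units.mk0 (1 - (a : F)⁻¹)
    (sub_ne_zero.2 fun h => ha' (by rw [← inv_inv (a : F), ← h, inv_one]))
  have h1 : ksymbol [a] * ksymbol [b] = 0 := ksymbol_mul_ksymbol_of_add_eq_one (by simp [b])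
  have h2 : ksymbol [a⁻¹] * ksymbol [c] = 0 := ksymbol_mul_ksymbol_of_add_eq_one (by simp [c])
  have h3 : -a * c = b := by
    ext
    simp only [b, c, Units.val_mul, Units.val_neg, Units.val_mk0]
    field_simp
    ring
  rw [← h3, ksymbol_mul, mul_add] at h1
  rw [ksymbol_inv, kring_neg_mul, neg_eq_zero] at h2
  rwa [h2, add_zero] at h1

lemma ksymbol_mul_comm (a b : Fˣ) : ksymbol [a] * ksymbol [b] = -(ksymbol [b] * ksymbol [a]) := by
  have h := ksymbol_mul_ksymbol_neg (a * b)
  have h1 : ksymbol [-(a * b)] = ksymbol [-a] + ksymbol [b] := by rw [← ksymbol_mul, neg_mul]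
  have h2 : ksymbol [-(a * b)] = ksymbol [a] + ksymbol [-b] := by rw [← ksymbol_mul, mul_neg]
  rw [ksymbol_mul, add_mul] at h
  nth_rw 1 [h1] at h
  rw [h2, mul_add, mul_add, ksymbol_mul_ksymbol_neg, ksymbol_mul_ksymbol_neg, zero_add,
    add_zero] at h
  exact eq_neg_of_add_eq_zero_left h

lemma ksymbol_mul_self (a : Fˣ) : ksymbol [a] * ksymbol [a] = -(ksymbol [a] * ksymbol [-1]) := by
  have h := ksymbol_mul_ksymbol_neg a
  rw [← mul_neg_one, ksymbol_mul, mul_add] at h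
  exact eq_neg_of_add_eq_zero_left h

/-- An entry of a symbol over a field can be moved to the front at the cost of a sign. -/
lemma ksymbol_middle (l l' : List Fˣ) (u : Fˣ) :
    ksymbol (l ++ u :: l') = ksymbol (u :: (l ++ l')) ∨
      ksymbol (l ++ u :: l') = -ksymbol (u :: (l ++ l')) := by
  induction l with
  | nil => exact Or.inl rfl
  | cons a l ih =>
    rw [List.cons_append, ksymbol_cons, List.cons_append, ksymbol_cons u, ksymbol_cons a (l ++ l'),
      ← mul_assoc (ksymbol [u]), ksymbol_mul_comm u a, kring_neg_mul, mul_assoc, ← ksymbol_cons u, neg_neg]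
    rcases ih with h | h
    · right; rw [h]
    · left; rw [h, kring_mul_neg]

/-- A symbol with entries in `⟨W, f⟩` is a sum of symbols in which `f` occurs at most once,
and then in the first place, all the other entries being in `W`. -/
lemma ksymbol_mem_closure_of_mem_mul_zpow (W : Subgroup Fˣ) (hW : -1 ∈ W) (f : Fˣ) (v : List Fˣ)
    (hv : ∀ x ∈ v, ∃ w ∈ W, ∃ m : ℤ, x = w * f ^ m) :
    ksymbol v ∈ AddSubgroup.closure
      ({x | ∃ l : List Fˣ, (∀ w ∈ l, w ∈ W) ∧ l.length = v.length ∧ x = ksymbol l} ∪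
       {x | ∃ l : List Fˣ, (∀ w ∈ l, w ∈ W) ∧ l.length + 1 = v.length ∧
          x = ksymbol (f :: l)}) := by
  induction v with
  | nil => exact AddSubgroup.subset_closure (Or.inl ⟨[], by simp, rfl, rfl⟩)
  | cons a v ih =>
    obtain ⟨w, hw, m, rfl⟩ := hv a (by simp)
    rw [ksymbol_cons, ksymbol_mul, ksymbol_zpow]
    have := ih fun x hx => hv x (by simp [hx])
    generalize ksymbol v = z at this ⊢
    induction this using AddSubgroup.closure_induction with
    | zero => rw [mul_zero]; exact zero_mem _
    | add x y _ _ hx hy => rw [mul_add]; exact add_mem hx hy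
    | neg x _ hx => rw [kring_mul_neg]; exact neg_mem hx
    | mem x hx =>
      have hcons : ∀ {b : Fˣ} {l : List Fˣ}, b ∈ W → (∀ c ∈ l, c ∈ W) → ∀ c ∈ b :: l, c ∈ W :=
        fun hb hl => List.forall_mem_cons.2 ⟨hb, hl⟩
      rw [add_mul, kring_zsmul_mul]
      rcases hx with ⟨l, hl, hlen, rfl⟩ | ⟨l, hl, hlen, rfl⟩
      · refine add_mem ?_ (AddSubgroup.zsmul_mem _ ?_ _)
        · rw [← ksymbol_cons]
          exact AddSubgroup.subset_closure (Or.inl ⟨_, hcons hw hl, by simp [hlen], rfl⟩)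
        · rw [← ksymbol_cons]
          exact AddSubgroup.subset_closure (Or.inr ⟨l, hl, by simp [hlen], rfl⟩)
      · rw [ksymbol_cons f, ← mul_assoc, ← mul_assoc, ksymbol_mul_comm w, ksymbol_mul_self, kring_neg_mul,
          kring_neg_mul, mul_assoc, mul_assoc, ← ksymbol_cons w, ← ksymbol_cons (-1), ← ksymbol_cons f,
          ← ksymbol_cons f]
        refine add_mem (neg_mem ?_) (AddSubgroup.zsmul_mem _ (neg_mem ?_) _)
        · exact AddSubgroup.subset_closure (Or.inr ⟨_, hcons hw hl, by simp [hlen], rfl⟩)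
        · exact AddSubgroup.subset_closure (Or.inr ⟨_, hcons hW hl, by simp [hlen], rfl⟩)

lemma ksymbol_mul_ksymbol_of_eq_one_add_mul {u a f : Fˣ} (hu : (u : F) = 1 + a * f) :
    ksymbol [u] * ksymbol [f] = -(ksymbol [u] * ksymbol [-a]) := by
  have h : ksymbol [u] * ksymbol [-a * f] = 0 :=
    ksymbol_mul_ksymbol_of_add_eq_one (by rw [hu]; push_cast; ring)
  rw [ksymbol_mul, mul_add, add_comm] at h
  exact eq_neg_of_add_eq_zero_left h

/-- The identity `{1 + xf, f} = -{(1 + xf) / (1 + x), (1 + x) / (f - 1)}`. -/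
lemma ksymbol_mul_ksymbol_eq_neg_div {u t h x f : Fˣ} (hu : (u : F) = 1 + x * f)
    (ht : (t : F) = 1 + x) (hh : (h : F) = f - 1) :
    ksymbol [u] * ksymbol [f] = -(ksymbol [u / t] * ksymbol [t / h]) := by
  have h1 : ksymbol [t] * ksymbol [-x] = 0 :=
    ksymbol_mul_ksymbol_of_add_eq_one (by rw [ht]; push_cast; ring)
  have h2 : ksymbol [u / t] * ksymbol [-x * (h / t)] = 0 := by
    refine ksymbol_mul_ksymbol_of_add_eq_one ?_
    have := t.ne_zero
    push_cast
    field_simp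
    rw [hu, ht, hh]
    ring
  have h3 : ksymbol [u] = ksymbol [u / t] + ksymbol [t] := by rw [← ksymbol_mul, div_mul_cancel]
  have h4 : ksymbol [h / t] = -ksymbol [t / h] := by rw [← ksymbol_inv, inv_div]
  rw [ksymbol_mul, mul_add, h4, kring_mul_neg, ← sub_eq_add_neg, sub_eq_zero] at h2
  rw [ksymbol_mul_ksymbol_of_eq_one_add_mul hu, h3, add_mul, h1, add_zero, h2]

end field

section kernel

variable {A B : Type*} [CommRing A] [CommRing B] (φ : A →+* B)

/-- The two-sided ideal of the Milnor ring generated by the symbols `{u}` with `φ u = 1`. -/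
def unitKernelIdeal : TwoSidedIdeal (KRing A) :=
  TwoSidedIdeal.span {x | ∃ u : Aˣ, φ u = 1 ∧ x = ksymbol [u]}

lemma mk_ksymbol_eq_mk_ksymbol {l l' : List Aˣ}
    (h : l.map (Units.map (φ : A →* B)) = l'.map (Units.map (φ : A →* B))) :
    (unitKernelIdeal φ).ringCon.mk' (ksymbol l) = (unitKernelIdeal φ).ringCon.mk' (ksymbol l') := by
  induction l generalizing l' with
  | nil =>
    obtain rfl : l' = [] := by simpa using h.symm
    rfl
  | cons a l ih =>
    obtain _ | ⟨b, l'⟩ := l'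
    · simp at h
    rw [List.map_cons, List.map_cons, List.cons.injEq] at h
    rw [ksymbol_cons a, ksymbol_cons b, map_mul, map_mul, ih h.2]
    congr 1
    refine (RingCon.eq _).2 (TwoSidedIdeal.rel_iff _ _ _ |>.2 ?_)
    rw [← ksymbol_div]
    refine TwoSidedIdeal.subset_span ⟨a / b, ?_, rfl⟩
    have : Units.map (φ : A →* B) (a / b) = 1 := by rw [map_div, h.1, div_self']
    exact congrArg Units.val this

variable {φ}

/-- The kernel of the map of Milnor rings induced by a surjective local homomorphism is generated
by the symbols `{u}` with `u` in the kernel on units. -/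
lemma mem_unitKernelIdeal_of_kmap_eq_zero [IsLocalHom φ] (hφ : Function.Surjective φ)
    {r : ℕ} {x : KRing A} (hx : x ∈ KGroup A r) (h : kmap φ x = 0) :
    x ∈ unitKernelIdeal φ := by
  have hsurj : Function.Surjective (Units.map (φ : A →* B)) := by
    intro b
    obtain ⟨a, ha⟩ := hφ b
    obtain ⟨u, rfl⟩ := isUnit_of_map_unit φ a (ha ▸ b.isUnit)
    exact ⟨u, Units.ext ha⟩
  choose s hs using hsurj
  let π := (unitKernelIdeal φ).ringCon.mk'
  let g : Additive Bˣ →+ (unitKernelIdeal φ).ringCon.Quotient :=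
    AddMonoidHom.mk' (fun b => π (ksymbol [s b.toMul])) fun b c => by
      rw [← map_add, ← ksymbol_mul]
      exact mk_ksymbol_eq_mk_ksymbol φ (by simp [hs])
  have hprod : ∀ l : List Bˣ, (l.map fun b => g (Additive.ofMul b)).prod =
      π (ksymbol (l.map s)) := by
    intro l
    induction l with
    | nil => rw [List.map_nil, List.map_nil, ksymbol_nil, map_one]; rfl
    | cons b l ih =>
      rw [List.map_cons, List.prod_cons, ih, List.map_cons, ksymbol_cons, map_mul]
      rfl
  have hmap : ∀ l : List Bˣ, (l.map s).map (Units.map (φ : A →* B)) = l := by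
    intro l
    simp [Function.comp_def, hs]
  let ψ : KRing B →+* (unitKernelIdeal φ).ringCon.Quotient := liftKRing g (by
    intro l i j hi hj hij hsum
    have h1 : φ (1 - s l[i]) = l[j] := by
      rw [map_sub, map_one, sub_eq_iff_eq_add', ← hsum]
      exact congrArg (fun b : Bˣ => (b : B) + l[j]) (hs l[i]).symm
    obtain ⟨c, hc⟩ := isUnit_of_map_unit φ (1 - s l[i] : A) (h1 ▸ l[j].isUnit)
    have hcφ : Units.map (φ : A →* B) c = l[j] := Units.ext (by rw [← h1, ← hc]; rfl)
    rw [hprod, mk_ksymbol_eq_mk_ksymbol φ (l' := (l.map s).set j c)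
      (by rw [List.map_set, hmap, hcφ, List.set_getElem_self])]
    rw [ksymbol_eq_zero_of_getElem_add_getElem _ i j (by simpa using hi) (by simpa using hj) hij,
      map_zero]
    rw [List.getElem_set_self, List.getElem_set_ne hij.symm, List.getElem_map, hc]
    ring)
  have hψ : ψ (kmap φ x) = π x := by
    clear h
    induction hx using AddSubgroup.closure_induction with
    | mem x hx =>
      obtain ⟨l, -, rfl⟩ := hx
      rw [kmap_ksymbol]
      refine (liftKRing_ksymbol _ _ _).trans ?_
      rw [hprod]
      exact mk_ksymbol_eq_mk_ksymbol φ (hmap _)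
    | zero => simp only [map_zero]
    | add x y _ _ hx hy => simp only [map_add, hx, hy]
    | neg x _ hx => rw [map_neg, map_neg, map_neg, hx]
  rw [h, map_zero] at hψ
  exact (TwoSidedIdeal.mem_iff _ _).2 ((RingCon.eq _).1 (hψ.symm.trans (map_zero π).symm))

/-- In degree `r`, the ideal generated by the `{u}` with `φ u = 1` is generated as a group by the
symbols of length `r` one of whose entries is such a unit. -/
lemma mem_closure_of_mem_unitKernelIdeal {r : ℕ} {x : KRing A} (hx : x ∈ KGroup A r)
    (h : x ∈ unitKernelIdeal φ) :
    x ∈ AddSubgroup.closure {x | ∃ (u : Aˣ) (l l' : List Aˣ), φ u = 1 ∧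
      (l ++ u :: l').length = r ∧ x = ksymbol (l ++ u :: l')} := by
  set S := AddSubgroup.closure {x | ∃ (u : Aˣ) (l l' : List Aˣ), φ u = 1 ∧
      (l ++ u :: l').length = r ∧ x = ksymbol (l ++ u :: l')}
  rw [← degreePart_eq_self A hx]
  rw [unitKernelIdeal, TwoSidedIdeal.mem_span_iff_mem_addSubgroup_closure] at h
  clear hx
  induction h using AddSubgroup.closure_induction with
  | zero => rw [map_zero]; exact S.zero_mem
  | add x y _ _ hx hy => rw [map_add]; exact S.add_mem hx hy
  | neg x _ hx => rw [map_neg]; exact S.neg_mem hx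
  | mem x hx =>
    obtain ⟨_, ⟨a, -, _, ⟨u, hu, rfl⟩, rfl⟩, b, -, rfl⟩ := hx
    have ha : a ∈ AddSubgroup.closure (Set.range (ksymbol (A := A))) := by
      rw [closure_range_ksymbol]; trivial
    have hb : b ∈ AddSubgroup.closure (Set.range (ksymbol (A := A))) := by
      rw [closure_range_ksymbol]; trivial
    show degreePart A r (a * ksymbol [u] * b) ∈ S
    induction ha, hb using AddSubgroup.closure_induction₂ with
    | mem x y hx hy =>
      obtain ⟨l, rfl⟩ := hx
      obtain ⟨l', rfl⟩ := hy
      rw [mul_assoc, ← ksymbol_cons, ← ksymbol_append, degreePart_ksymbol]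
      split_ifs with hlen
      · exact AddSubgroup.subset_closure ⟨u, l, l', hu, hlen, rfl⟩
      · exact S.zero_mem
    | zero_left x hx => rw [zero_mul, zero_mul, map_zero]; exact S.zero_mem
    | zero_right x hx => rw [mul_zero, map_zero]; exact S.zero_mem
    | add_left x y z _ _ _ h1 h2 => rw [add_mul, add_mul, map_add]; exact S.add_mem h1 h2
    | add_right x y z _ _ _ h1 h2 => rw [mul_add, map_add]; exact S.add_mem h1 h2
    | neg_left x y _ _ h =>
      rw [kring_neg_mul, kring_neg_mul, map_neg]; exact S.neg_mem h
    | neg_right x y _ _ h => rw [kring_mul_neg, map_neg]; exact S.neg_mem h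

end kernel

section fraction

variable {A : Type*} [CommRing A]

/-- The inclusion of the units of `A` into the units of its fraction field. -/
noncomputable abbrev fracUnit : Aˣ →* (FractionRing A)ˣ :=
  Units.map ((algebraMap A (FractionRing A)) : A →* FractionRing A)

/-- The symbol `{u, w₂, …, w_r}` with `u` congruent to `1` modulo `J` and all entries units of
`A` lies in `E_r(A, J)`. -/
lemma ksymbol_fracUnit_mem_eGroup {J : Ideal A} {u : Aˣ} (hu : (u : A) - 1 ∈ J) (l : List Aˣ) :
    ksymbol (fracUnit u :: l.map fracUnit) ∈ eGroup A J (l.length + 1) := by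
  refine ⟨ksymbol (u :: l), ⟨AddSubgroup.subset_closure ⟨_, rfl, rfl⟩, ?_⟩, kmap_ksymbol _ _⟩
  have h1 : Units.map (Ideal.Quotient.mk J : A →* A ⧸ J) u = 1 :=
    Units.ext ((Ideal.Quotient.eq.2 hu).trans (map_one _))
  show kmap _ _ = 0
  rw [kmap_ksymbol, List.map_cons, h1, ksymbol_cons, ksymbol_one, zero_mul]

variable [IsDomain A]

/-- A nonzero element of `A` as a unit of the fraction field. -/
noncomputable def fracUnitOfNeZero {f : A} (hf : f ≠ 0) : (FractionRing A)ˣ :=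
  Units.mk0 (algebraMap A (FractionRing A) f)
    ((map_ne_zero_iff _ (IsFractionRing.injective A (FractionRing A))).2 hf)

lemma memAwayUnits_fracUnit (g : A) (a : Aˣ) : memAwayUnits A g (fracUnit a) := by
  refine ⟨Subring.subset_closure (Or.inl ⟨a, rfl⟩), ?_⟩
  rw [← map_inv]
  exact Subring.subset_closure (Or.inl ⟨(a⁻¹ : Aˣ), rfl⟩)

lemma exists_mul_pow_of_mem_awaySubring {g : A} (hg : g ≠ 0) {z : FractionRing A}
    (hz : z ∈ awaySubring A g) :
    ∃ (m : ℕ) (a : A), z * algebraMap A (FractionRing A) g ^ m = algebraMap A _ a := by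
  have hg' : algebraMap A (FractionRing A) g ≠ 0 := (fracUnitOfNeZero hg).ne_zero
  induction hz using Subring.closure_induction with
  | mem z hz =>
    rcases hz with ⟨a, rfl⟩ | rfl
    · exact ⟨0, a, by simp⟩
    · exact ⟨1, 1, by rw [pow_one, inv_mul_cancel₀ hg', map_one]⟩
  | zero => exact ⟨0, 0, by simp⟩
  | one => exact ⟨0, 1, by simp⟩
  | add x y _ _ hx hy =>
    obtain ⟨m, a, ha⟩ := hx
    obtain ⟨n, b, hb⟩ := hy
    refine ⟨m + n, a * g ^ n + b * g ^ m, ?_⟩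
    rw [map_add, map_mul, map_mul, ← ha, ← hb, map_pow, map_pow]
    ring
  | neg x _ hx =>
    obtain ⟨m, a, ha⟩ := hx
    exact ⟨m, -a, by rw [map_neg, ← ha, neg_mul]⟩
  | mul x y _ _ hx hy =>
    obtain ⟨m, a, ha⟩ := hx
    obtain ⟨n, b, hb⟩ := hy
    refine ⟨m + n, a * b, ?_⟩
    rw [map_mul, ← ha, ← hb]
    ring

/-- If `f` is prime, the units of `A[1/f]` are the elements `w f ^ m` with `w` a unit of `A`. -/
lemma exists_eq_fracUnit_mul_zpow {f : A} (hf : Prime f) {k : ℕ} {v : (FractionRing A)ˣ}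
    (hv : memAwayUnits A (f ^ k) v) :
    ∃ (w : Aˣ) (m : ℤ), v = fracUnit w * fracUnitOfNeZero hf.ne_zero ^ m := by
  obtain ⟨m, a, ha⟩ := exists_mul_pow_of_mem_awaySubring (pow_ne_zero k hf.ne_zero) hv.1
  obtain ⟨n, b, hb⟩ := exists_mul_pow_of_mem_awaySubring (pow_ne_zero k hf.ne_zero) hv.2
  have hab : a * b = f ^ (k * m + k * n) := by
    apply IsFractionRing.injective A (FractionRing A)
    rw [map_mul, ← ha, ← hb, mul_mul_mul_comm, Units.mul_inv, one_mul, map_pow, map_pow,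
      pow_add, pow_mul, pow_mul]
  obtain ⟨i, -, w, hw⟩ := (dvd_prime_pow hf _).1 (Dvd.intro _ hab)
  refine ⟨w⁻¹, (i : ℤ) - (k * m : ℕ), ?_⟩
  have h1 : v * fracUnitOfNeZero hf.ne_zero ^ (k * m) * fracUnit w =
      fracUnitOfNeZero hf.ne_zero ^ i := by
    ext
    simp only [fracUnitOfNeZero, Units.val_mul, Units.val_pow_eq_pow_val, Units.val_mk0,
      Units.coe_map, MonoidHom.coe_coe]
    rw [← map_pow (algebraMap A (FractionRing A)) f i, ← hw, map_mul, ← ha, map_pow, pow_mul]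
  rw [zpow_sub, zpow_natCast, zpow_natCast, ← h1, map_inv, mul_comm (v * _), mul_assoc,
    inv_mul_cancel_left, mul_inv_cancel_right]

/-- `K̂_r(A|J') ⊆ E_r(A, J)` as soon as all symbols `{u, f, w₃, …}` with `u` congruent to `1`
modulo `J'` and `wᵢ` units of `A` lie in `E(A, J)`. -/
lemma hatKGroup_le_eGroup {f : A} (hf : Prime f) (k : ℕ) {J J' : Ideal A} (hJ : J' ≤ J)
    (H : ∀ u : Aˣ, (u : A) - 1 ∈ J' → ∀ l : List Aˣ,
      ksymbol (fracUnit u :: fracUnitOfNeZero hf.ne_zero :: l.map fracUnit) ∈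
        eGroup A J (l.length + 2)) {r : ℕ} (hr : 1 ≤ r) :
    hatKGroup A (f ^ k) J' r ≤ eGroup A J r := by
  rw [hatKGroup, AddSubgroup.closure_le]
  rintro _ ⟨u, hu, v, hlen, hv, rfl⟩
  have hlift : ∀ l : List (FractionRing A)ˣ,
      (∀ w ∈ l, w ∈ (fracUnit (A := A)).range) → ∃ l' : List Aˣ, l'.map fracUnit = l := by
    intro l hl
    induction l with
    | nil => exact ⟨[], rfl⟩
    | cons x l ih =>
      obtain ⟨a, rfl⟩ := hl x List.mem_cons_self
      obtain ⟨l', rfl⟩ := ih fun w hw => hl w (List.mem_cons_of_mem _ hw)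
      exact ⟨a :: l', rfl⟩
  have key := ksymbol_mem_closure_of_mem_mul_zpow (fracUnit (A := A)).range
    ⟨-1, by ext; simp⟩ (fracUnitOfNeZero hf.ne_zero) v (by
      intro x hx
      obtain ⟨w, m, h⟩ := exists_eq_fracUnit_mul_zpow hf (hv x hx)
      exact ⟨_, ⟨w, rfl⟩, m, h⟩)
  rw [ksymbol_cons]
  generalize ksymbol v = z at key ⊢
  show _ ∈ eGroup A J r
  induction key using AddSubgroup.closure_induction with
  | zero => rw [mul_zero]; exact zero_mem _
  | add x y _ _ hx hy => rw [mul_add]; exact add_mem hx hy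
  | neg x _ hx => rw [kring_mul_neg]; exact neg_mem hx
  | mem x hx =>
    rcases hx with ⟨l, hl, hl', rfl⟩ | ⟨l, hl, hl', rfl⟩
    · obtain ⟨l, rfl⟩ := hlift l hl
      rw [← ksymbol_cons]
      obtain rfl : r = l.length + 1 := by rw [List.length_map] at hl'; omega
      exact ksymbol_fracUnit_mem_eGroup (hJ hu) l
    · obtain ⟨l, rfl⟩ := hlift l hl
      rw [← ksymbol_cons]
      obtain rfl : r = l.length + 2 := by rw [List.length_map] at hl'; omega
      exact H u hu l

/-- `E_r(A, J) ⊆ K̂_r(A|J)` for a proper ideal `J` of a local domain. -/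
lemma eGroup_le_hatKGroup [IsLocalRing A] (g : A) {J : Ideal A} (hJ : J ≠ ⊤) (r : ℕ) :
    eGroup A J r ≤ hatKGroup A g J r := by
  have : Nontrivial (A ⧸ J) := Ideal.Quotient.nontrivial_iff.2 hJ
  have : IsLocalHom (Ideal.Quotient.mk J) := .of_surjective _ Ideal.Quotient.mk_surjective
  rintro _ ⟨x, ⟨hx, hker⟩, rfl⟩
  have h := mem_closure_of_mem_unitKernelIdeal hx
    (mem_unitKernelIdeal_of_kmap_eq_zero Ideal.Quotient.mk_surjective hx hker)
  clear hx hker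
  show kmap _ x ∈ _
  induction h using AddSubgroup.closure_induction with
  | zero => rw [map_zero]; exact zero_mem _
  | add x y _ _ hx hy => rw [map_add]; exact add_mem hx hy
  | neg x _ hx => rw [map_neg]; exact neg_mem hx
  | mem x hx =>
    obtain ⟨u, l, l', hu, hlen, rfl⟩ := hx
    have hmem : ksymbol (fracUnit u :: (l.map fracUnit ++ l'.map fracUnit)) ∈
        hatKGroup A g J r := by
      refine AddSubgroup.subset_closure ⟨u, Ideal.Quotient.eq.1 (hu.trans (map_one _).symm), _, ?_,
        ?_, rfl⟩
      · simp only [List.length_append, List.length_cons, List.length_map] at hlen ⊢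
        omega
      · intro w hw
        rw [← List.map_append] at hw
        obtain ⟨a, -, rfl⟩ := List.mem_map.1 hw
        exact memAwayUnits_fracUnit g a
    rw [kmap_ksymbol, List.map_append, List.map_cons]
    rcases ksymbol_middle (l.map fracUnit) (l'.map fracUnit) (fracUnit u) with h | h
    · exact h ▸ hmem
    · exact h ▸ neg_mem hmem

/-- For `u = 1 + a f ^ (n + 1)` and `n ≥ 1`, the symbol `{u, f, w₃, …}` lies in
`E(A, (f ^ n))`. -/
lemma ksymbol_mem_eGroup_pow [IsLocalRing A] {f : A} (hf : f ≠ 0) (hfu : ¬IsUnit f) {n : ℕ}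
    (hn : 1 ≤ n) (u : Aˣ) (hu : (u : A) - 1 ∈ Ideal.span {f ^ (n + 1)}) (l : List Aˣ) :
    ksymbol (fracUnit u :: fracUnitOfNeZero hf :: l.map fracUnit) ∈
      eGroup A (Ideal.span {f ^ n}) (l.length + 2) := by
  obtain ⟨a, ha⟩ := Ideal.mem_span_singleton.1 hu
  rcases eq_or_ne a 0 with rfl | ha0
  · obtain rfl : u = 1 := Units.ext (by rw [mul_zero] at ha; exact sub_eq_zero.1 ha)
    rw [map_one, ksymbol_cons, ksymbol_one, zero_mul]
    exact zero_mem _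
  have hx0 : f ^ n * a ≠ 0 := mul_ne_zero (pow_ne_zero n hf) ha0
  have hfm : f ∈ IsLocalRing.maximalIdeal A := (IsLocalRing.mem_maximalIdeal f).2 hfu
  have hxm : f ^ n * a ∈ IsLocalRing.maximalIdeal A :=
    Ideal.mul_mem_right _ _ (Ideal.pow_mem_of_mem _ hfm n hn)
  obtain ⟨t, ht⟩ : IsUnit (1 + f ^ n * a) := by
    simpa using IsLocalRing.isUnit_one_sub_self_of_mem_nonunits _ (neg_mem hxm)
  obtain ⟨h, hh⟩ : IsUnit (f - 1) := by
    simpa using (IsLocalRing.isUnit_one_sub_self_of_mem_nonunits f hfu).neg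
  have hu' : (u : A) = 1 + f ^ n * a * f := by
    rw [← sub_eq_iff_eq_add', ha]
    ring
  have key : ksymbol [fracUnit u] * ksymbol [fracUnitOfNeZero hf] =
      -(ksymbol [fracUnit (u / t)] * ksymbol [fracUnit (t / h)]) := by
    rw [map_div, map_div]
    refine ksymbol_mul_ksymbol_eq_neg_div (x := fracUnitOfNeZero hx0) ?_ ?_ ?_
    · simp [fracUnitOfNeZero, hu']
    · simp [fracUnitOfNeZero, ht]
    · simp [fracUnitOfNeZero, hh]
  rw [ksymbol_cons, ksymbol_cons (fracUnitOfNeZero hf), ← mul_assoc, key, kring_neg_mul, mul_assoc,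
    ← ksymbol_cons, ← ksymbol_cons, ← List.map_cons]
  refine neg_mem (ksymbol_fracUnit_mem_eGroup (l := (t / h) :: l) ?_)
  have hut : ((u / t : Aˣ) : A) - 1 = f ^ n * (a * (f - 1) * ↑t⁻¹) := by
    have h1 : (t : A) * ↑t⁻¹ = 1 := t.mul_inv
    rw [div_eq_mul_inv, Units.val_mul, hu']
    rw [ht] at h1
    linear_combination h1
  rw [hut]
  exact Ideal.mul_mem_right _ _ (Ideal.mem_span_singleton_self _)

/-- For `u = 1 + a f`, the symbol `{u, f, w₃, …}` lies in `E(A, (f))`. -/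
lemma ksymbol_mem_eGroup_span_singleton [IsLocalRing A] {f : A} (hf : f ≠ 0) (hfu : ¬IsUnit f)
    (u : Aˣ) (hu : (u : A) - 1 ∈ Ideal.span {f}) (l : List Aˣ) :
    ksymbol (fracUnit u :: fracUnitOfNeZero hf :: l.map fracUnit) ∈
      eGroup A (Ideal.span {f}) (l.length + 2) := by
  have hunit : ∀ (u a : Aˣ), (u : A) = 1 + a * f →
      ksymbol (fracUnit u :: fracUnitOfNeZero hf :: l.map fracUnit) ∈
        eGroup A (Ideal.span {f}) (l.length + 2) := by
    intro u a hu
    have key : ksymbol [fracUnit u] * ksymbol [fracUnitOfNeZero hf] =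
        -(ksymbol [fracUnit u] * ksymbol [fracUnit (-a)]) := by
      rw [ksymbol_mul_ksymbol_of_eq_one_add_mul (a := fracUnit a)]
      · congr 4
        ext
        simp
      · simp [fracUnitOfNeZero, hu]
    rw [ksymbol_cons, ksymbol_cons (fracUnitOfNeZero hf), ← mul_assoc, key, kring_neg_mul,
      mul_assoc, ← ksymbol_cons, ← ksymbol_cons, ← List.map_cons]
    refine neg_mem (ksymbol_fracUnit_mem_eGroup (l := (-a) :: l) ?_)
    rw [hu, add_sub_cancel_left]
    exact Ideal.mul_mem_left _ _ (Ideal.mem_span_singleton_self _)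
  obtain ⟨a, ha⟩ := Ideal.mem_span_singleton.1 hu
  have hu' : (u : A) = 1 + a * f := by rw [← sub_eq_iff_eq_add', ha, mul_comm]
  by_cases hau : IsUnit a
  · obtain ⟨a, rfl⟩ := hau
    exact hunit u a hu'
  obtain ⟨b, hb⟩ : IsUnit (a - 1) := by
    simpa using (IsLocalRing.isUnit_one_sub_self_of_mem_nonunits a hau).neg
  obtain ⟨t, ht⟩ : IsUnit (1 + f) := by
    simpa using IsLocalRing.isUnit_one_sub_self_of_mem_nonunits (-f) (by simpa using hfu)
  have h1 := hunit t 1 (by rw [ht, Units.val_one, one_mul])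
  have h2 := hunit (u / t) (b / t) (by
    have h1 : (t : A) * ↑t⁻¹ = 1 := t.mul_inv
    rw [div_eq_mul_inv, div_eq_mul_inv, Units.val_mul, Units.val_mul, hu', hb]
    rw [ht] at h1
    linear_combination h1)
  have h3 := add_mem h2 h1
  rwa [ksymbol_cons, ksymbol_cons (fracUnit t), ← add_mul, ← ksymbol_mul, ← map_mul,
    div_mul_cancel, ← ksymbol_cons] at h3

end fraction

end MilnorKTheory

open MilnorKTheory in
/-- Let `k` be a perfect field of characteristic `p > 0`, let `A` be a
regular local ring essentially of finite type over `k`, and let `f ∈ A` be a nonzero element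
such that `R = A/(f)` is regular.  Let `F` be the fraction field of `A` and set `I = (f)`, so
`Iⁿ = (fⁿ)`.  Then for every `r ≥ 1` and every `n ≥ 1` one has
`K̂^M_r(A|I^{n+1}) ⊆ E_r(A, Iⁿ)` as subgroups of `K^M_r(F)` (where `K̂^M_r(A|I^{n+1})` is
computed with the localization element `g = f^{n+1}`); moreover `E_r(A,I) = K̂^M_r(A|I)`. -/
theorem hatKGroup_le_eGroup_of_regular
    (p : ℕ) (hp : p.Prime) (k : Type*) [Field k] [PerfectField k] [CharP k p]
    (A : Type*) [CommRing A] [IsDomain A] [IsLocalRing A] [Algebra k A]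
    [Algebra.EssFiniteType k A] (hA : IsRegularLocal A)
    (f : A) (hf : f ≠ 0) (hR : IsRegularLocal (A ⧸ Ideal.span {f}))
    (r : ℕ) (hr : 1 ≤ r) :
    (∀ n : ℕ, 1 ≤ n →
      hatKGroup A (f ^ (n + 1)) (Ideal.span {f ^ (n + 1)}) r ≤
        eGroup A (Ideal.span {f ^ n}) r) ∧
    eGroup A (Ideal.span {f}) r = hatKGroup A f (Ideal.span {f}) r := by
  have hprime : Prime f :=
    (Ideal.span_singleton_prime hf).1 ((Ideal.Quotient.isDomain_iff_prime _).1 hR.isDomain)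
  refine ⟨fun n hn => ?_, le_antisymm ?_ ?_⟩
  · refine hatKGroup_le_eGroup hprime (n + 1) ?_ (fun u hu l => ?_) hr
    · exact Ideal.span_singleton_le_span_singleton.2 (pow_dvd_pow f n.le_succ)
    · exact ksymbol_mem_eGroup_pow hf hprime.not_isUnit hn u hu l
  · exact eGroup_le_hatKGroup f (fun h => hprime.not_isUnit (Ideal.span_singleton_eq_top.1 h)) r
  · have := hatKGroup_le_eGroup hprime 1 le_rfl (fun u hu l =>
      ksymbol_mem_eGroup_span_singleton hf hprime.not_isUnit u hu l) hr
    rwa [pow_one] at this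
end

section
/- Let p be a prime, A an 𝔽_p-algebra, f ∈ A, and A_f = A[1/f]. For m ≥ 1 and n ∈ ℤ let W_m^{(n)}(A,f) := [f]^{-n}·ι(W_m(A)) ⊆ W_m(A_f). Then for all integers m > i ≥ 1 and all n ∈ ℤ, the sequence 0 → W_{m-i}^{(p^i n)}(A,f) →(V^i)→ W_m^{(n)}(A,f) →(R^{m-i})→ W_i^{(n)}(A,f) → 0 is exact; that is, the i-fold Verschiebung V^i is injective with image equal to the kernel of the (m−i)-fold restriction R^{m-i} restricted to W_m^{(n)}(A,f), and R^{m-i}: W_m^{(n)}(A,f) → W_i^{(n)}(A,f) is surjective. -/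
noncomputable section

open TruncatedWittVector

variable (p : ℕ) [hp : Fact p.Prime]

/-- The coordinatewise map of truncated Witt vectors along a ring homomorphism. -/
def twvMap {B C : Type*} [CommRing B] [CommRing C] (φ : B →+* C) {m : ℕ}
    (x : TruncatedWittVector p m B) : TruncatedWittVector p m C :=
  TruncatedWittVector.mk p fun i => φ (x.coeff i)

/-- The Verschiebung `V : W_m(B) → W_{m+1}(B)`, shifting coordinates by one. -/
def twvV {B : Type*} [CommRing B] {m : ℕ} (x : TruncatedWittVector p m B) :
    TruncatedWittVector p (m + 1) B :=
  TruncatedWittVector.mk p (Fin.cases 0 fun i => x.coeff i)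

/-- The Frobenius `F : W_{m+1}(B) → W_m(B)` of a ring `B` of characteristic `p`,
induced coordinatewise by the `p`-th power map composed with truncation. -/
def twvF {B : Type*} [CommRing B] {m : ℕ} (x : TruncatedWittVector p (m + 1) B) :
    TruncatedWittVector p m B :=
  TruncatedWittVector.mk p fun i => (x.coeff i.castSucc) ^ p

/-- The restriction (truncation) `R : W_{m+1}(B) → W_m(B)`. -/
def twvR {B : Type*} [CommRing B] {m : ℕ} :
    TruncatedWittVector p (m + 1) B →+* TruncatedWittVector p m B :=
  TruncatedWittVector.truncate (Nat.le_succ m)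

/-- The `i`-fold iterated Verschiebung `V^i : W_a(B) → W_{a+i}(B)`. -/
def twvViter {B : Type*} [CommRing B] : (i : ℕ) → {a : ℕ} →
    TruncatedWittVector p a B → TruncatedWittVector p (a + i) B
  | 0, _, x => x
  | i + 1, _, x => twvV p (twvViter i x)

/-- The `j`-fold iterated Frobenius `F^j : W_{j+1}(B) → W_1(B)`. -/
def twvFpow {B : Type*} [CommRing B] : {j : ℕ} →
    TruncatedWittVector p (j + 1) B → TruncatedWittVector p 1 B
  | 0, x => x
  | _ + 1, x => twvFpow (twvF p x)

/-- The Teichmüller representative `[·] : B →* W_m(B)`. -/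
def twvTeichmuller {B : Type*} [CommRing B] (m : ℕ) : B →* TruncatedWittVector p m B :=
  (WittVector.truncate m).toMonoidHom.comp (WittVector.teichmuller p)

variable (A : Type*) [CommRing A] (f : A)

/-- `f` becomes a unit in the localization `A_f = A[1/f]`. -/
def awayUnit : (Localization.Away f)ˣ :=
  (IsLocalization.Away.algebraMap_isUnit (S := Localization.Away f) f).unit

/-- The Teichmüller representative `[f]` of `f`, as a unit of `W_m(A_f)`. -/
def twvTeichUnit (m : ℕ) : (TruncatedWittVector p m (Localization.Away f))ˣ :=
  Units.map (twvTeichmuller p (B := Localization.Away f) m) (awayUnit A f)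

/-- The canonical (coordinatewise) map `ι : W_m(A) → W_m(A_f)`. -/
def twvLoc (m : ℕ) (x : TruncatedWittVector p m A) :
    TruncatedWittVector p m (Localization.Away f) :=
  twvMap p (algebraMap A (Localization.Away f)) x

/-- The twisted subset `W_m^{(n)}(A,f) = [f]^{-n} · ι(W_m(A)) ⊆ W_m(A_f)`. -/
def twistedWitt (m : ℕ) (n : ℤ) : Set (TruncatedWittVector p m (Localization.Away f)) :=
  { y | ∃ x : TruncatedWittVector p m A,
      y = (↑(twvTeichUnit p A f m ^ (-n)) : TruncatedWittVector p m (Localization.Away f))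
            * twvLoc p A f m x }

end

namespace WittVector

variable {p : ℕ} [hp : Fact p.Prime] {R : Type*} [CommRing R]

/-- A Witt vector is the sum of the Teichmüller lift of its zeroth coefficient and the
Verschiebung of its shift. -/
theorem teichmuller_add_verschiebung_shift (x : WittVector p R) :
    teichmuller p (x.coeff 0) + verschiebung (x.shift 1) = x := by
  ext k
  rw [coeff_add_of_disjoint]
  · cases k with
    | zero => simp
    | succ k => simp [teichmuller_coeff_pos, shift_coeff, add_comm]
  · intro k
    cases k with
    | zero => simp
    | succ k => simp [teichmuller_coeff_pos]

theorem frobenius_teichmuller_of_charP [CharP R p] (a : R) :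
    frobenius (teichmuller p a) = teichmuller p (a ^ p) := by
  ext k
  rw [coeff_frobenius_charP]
  cases k with
  | zero => simp [-map_pow]
  | succ k => simp [-map_pow, teichmuller_coeff_pos, hp.out.ne_zero]

theorem coeff_teichmuller_mul [CharP R p] (a : R) (x : WittVector p R) (k : ℕ) :
    (teichmuller p a * x).coeff k = a ^ p ^ k * x.coeff k := by
  induction k generalizing a x with
  | zero => simp [mul_coeff_zero]
  | succ k ih =>
    conv_lhs => rw [← teichmuller_add_verschiebung_shift x]
    rw [mul_add, ← map_mul, mul_comm _ (verschiebung _), ← verschiebung_mul_frobenius,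
      mul_comm _ (frobenius _), frobenius_teichmuller_of_charP, coeff_add_of_disjoint]
    · simp [-map_pow, -map_mul, teichmuller_coeff_pos, ih, shift_coeff, ← pow_mul, pow_succ', add_comm]
    · intro l
      cases l with
      | zero => simp
      | succ l => simp [-map_pow, -map_mul, teichmuller_coeff_pos]

end WittVector

theorem coeff_twvTeichmuller_mul {p : ℕ} [Fact p.Prime] {B : Type*} [CommRing B]
    [Algebra (ZMod p) B] {m : ℕ} (a : B) (x : TruncatedWittVector p m B) (k : Fin m) :
    (twvTeichmuller p m a * x).coeff k = a ^ p ^ (k : ℕ) * x.coeff k := by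
  nontriviality B
  have : CharP B p := charP_of_injective_algebraMap' (ZMod p) p
  obtain ⟨x, rfl⟩ := WittVector.truncate_surjective p m B x
  change (WittVector.truncate m (WittVector.teichmuller p a) * _).coeff k = _
  rw [← map_mul, WittVector.coeff_truncate, WittVector.coeff_truncate,
    WittVector.coeff_teichmuller_mul]

theorem twvViter_coeff_of_lt {p : ℕ} {B : Type*} [CommRing B] (i : ℕ) {a : ℕ}
    (x : TruncatedWittVector p a B) (k : Fin (a + i)) (hk : (k : ℕ) < i) :
    (twvViter p i x).coeff k = 0 := by
  induction i with
  | zero => omega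
  | succ i ih =>
    refine Fin.cases (fun _ => ?_) (fun l hl => ?_) k hk
    · simp [twvViter, twvV]
    · simpa [twvViter, twvV] using ih l (by simpa using hl)

theorem twvViter_coeff_addNat {p : ℕ} {B : Type*} [CommRing B] (i : ℕ) {a : ℕ}
    (x : TruncatedWittVector p a B) (k : Fin a) :
    (twvViter p i x).coeff (k.addNat i) = x.coeff k := by
  induction i with
  | zero => rfl
  | succ i ih =>
    rw [← ih]
    exact TruncatedWittVector.coeff_mk ..

/-- Membership in the twisted Witt vectors is a coordinatewise condition. -/
theorem mem_twistedWitt_iff {p : ℕ} [Fact p.Prime] {A : Type*} [CommRing A]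
    [Algebra (ZMod p) A] {f : A} {m : ℕ} {n : ℤ}
    {y : TruncatedWittVector p m (Localization.Away f)} :
    y ∈ twistedWitt p A f m n ↔ ∀ k : Fin m, ∃ a : A,
      y.coeff k = ↑(awayUnit A f ^ (-((p : ℤ) ^ (k : ℕ) * n))) *
        algebraMap A (Localization.Away f) a := by
  have key (x : TruncatedWittVector p m A) (k : Fin m) :
      ((↑(twvTeichUnit p A f m ^ (-n)) : TruncatedWittVector p m (Localization.Away f))
          * twvLoc p A f m x).coeff k =
        ↑(awayUnit A f ^ (-((p : ℤ) ^ (k : ℕ) * n))) *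
          algebraMap A (Localization.Away f) (x.coeff k) := by
    rw [twvTeichUnit, ← map_zpow, Units.coe_map, coeff_twvTeichmuller_mul,
      ← Units.val_pow_eq_pow_val, ← zpow_natCast, ← zpow_mul, twvLoc, twvMap,
      TruncatedWittVector.coeff_mk]
    congr 3
    push_cast
    ring
  constructor
  · rintro ⟨x, rfl⟩ k
    exact ⟨x.coeff k, key x k⟩
  · intro h
    choose a ha using h
    refine ⟨TruncatedWittVector.mk p a, TruncatedWittVector.ext fun k => ?_⟩
    rw [key, ha, TruncatedWittVector.coeff_mk]

/-- Let `p` be a prime, `A` an `𝔽_p`-algebra, `f ∈ A`, and `A_f = A[1/f]`.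
For `m ≥ 1` and `n ∈ ℤ` let `W_m^{(n)}(A,f) := [f]^{-n}·ι(W_m(A)) ⊆ W_m(A_f)`.  Then for all
integers `m > i ≥ 1` and all `n ∈ ℤ` (below we write `m = j + i` with `j = m - i ≥ 1`), the
sequence
`0 → W_{m-i}^{(pⁱn)}(A,f) --V^i--> W_m^{(n)}(A,f) --R^{m-i}--> W_i^{(n)}(A,f) → 0`
is exact: the `i`-fold Verschiebung `V^i` is injective with image equal to the kernel of the
`(m-i)`-fold restriction `R^{m-i}` restricted to `W_m^{(n)}(A,f)`, and
`R^{m-i} : W_m^{(n)}(A,f) → W_i^{(n)}(A,f)` is surjective. -/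
theorem twistedWitt_verschiebung_restriction_exact
    (p : ℕ) [Fact p.Prime] (A : Type*) [CommRing A] [Algebra (ZMod p) A] (f : A)
    (i j : ℕ) (hi : 1 ≤ i) (hj : 1 ≤ j) (n : ℤ) :
    Set.InjOn (twvViter p i) (twistedWitt p A f j ((p : ℤ) ^ i * n)) ∧
    (twvViter p i) '' (twistedWitt p A f j ((p : ℤ) ^ i * n)) =
      { x ∈ twistedWitt p A f (j + i) n |
          TruncatedWittVector.truncate (Nat.le_add_left i j) x = 0 } ∧
    Set.MapsTo (TruncatedWittVector.truncate (Nat.le_add_left i j))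
      (twistedWitt p A f (j + i) n) (twistedWitt p A f i n) ∧
    Set.SurjOn (TruncatedWittVector.truncate (Nat.le_add_left i j))
      (twistedWitt p A f (j + i) n) (twistedWitt p A f i n) := by
  refine ⟨fun x _ y _ hxy => ?_, ?_, fun x hx => ?_, fun y hy => ?_⟩
  · ext k
    rw [← twvViter_coeff_addNat i x, ← twvViter_coeff_addNat i y, hxy]
  · ext y
    constructor
    · rintro ⟨x, hx, rfl⟩
      rw [mem_twistedWitt_iff] at hx
      refine ⟨mem_twistedWitt_iff.2 fun k => ?_, TruncatedWittVector.ext fun k => ?_⟩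
      · by_cases hk : (k : ℕ) < i
        · exact ⟨0, by rw [twvViter_coeff_of_lt i x k hk, map_zero, mul_zero]⟩
        · obtain ⟨l, rfl⟩ : ∃ l : Fin j, l.addNat i = k :=
            ⟨⟨k - i, by omega⟩, Fin.ext (by simp; omega)⟩
          obtain ⟨a, ha⟩ := hx l
          refine ⟨a, ?_⟩
          rw [twvViter_coeff_addNat, ha, Fin.val_addNat, pow_add, mul_assoc]
      · rw [TruncatedWittVector.coeff_truncate, TruncatedWittVector.coeff_zero]
        exact twvViter_coeff_of_lt i x _ k.2
    · rintro ⟨hy, hy0⟩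
      rw [mem_twistedWitt_iff] at hy
      refine ⟨TruncatedWittVector.mk p fun k => y.coeff (k.addNat i),
        mem_twistedWitt_iff.2 fun k => ?_, TruncatedWittVector.ext fun k => ?_⟩
      · obtain ⟨a, ha⟩ := hy (k.addNat i)
        refine ⟨a, ?_⟩
        rw [TruncatedWittVector.coeff_mk, ha, Fin.val_addNat, pow_add, mul_assoc]
      · by_cases hk : (k : ℕ) < i
        · rw [twvViter_coeff_of_lt i _ k hk]
          have := congrArg (TruncatedWittVector.coeff ⟨k, hk⟩) hy0
          rw [TruncatedWittVector.coeff_truncate, TruncatedWittVector.coeff_zero] at this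
          exact this.symm
        · obtain ⟨l, rfl⟩ : ∃ l : Fin j, l.addNat i = k :=
            ⟨⟨k - i, by omega⟩, Fin.ext (by simp; omega)⟩
          rw [twvViter_coeff_addNat, TruncatedWittVector.coeff_mk]
  · rw [mem_twistedWitt_iff] at hx ⊢
    intro k
    rw [TruncatedWittVector.coeff_truncate]
    exact hx (Fin.castLE _ k)
  · rw [mem_twistedWitt_iff] at hy
    refine ⟨TruncatedWittVector.mk p fun k => if h : (k : ℕ) < i then y.coeff ⟨k, h⟩ else 0,
      mem_twistedWitt_iff.2 fun k => ?_, TruncatedWittVector.ext fun k => ?_⟩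
    · rw [TruncatedWittVector.coeff_mk]
      split_ifs with hk
      · exact hy ⟨k, hk⟩
      · exact ⟨0, by rw [map_zero, mul_zero]⟩
    · rw [TruncatedWittVector.coeff_truncate, TruncatedWittVector.coeff_mk]
      exact dif_pos k.2
end

section
/- Let k be a perfect field of characteristic p > 0 and let A be a regular (in particular normal and reduced) domain that is essentially of finite type over k (normal Noetherian domain containing 𝔽_p suffices). Let f ∈ A be nonzero and A_f = A[1/f]. Let p̄: W_m(A_f) → W_{m+1}(A_f) be the unique additive map with p̄ ∘ R = p·(−) on W_{m+1}(A_f), and similarly p̄: W_m(A) → W_{m+1}(A). Then the square formed by p̄: W_m(A) → W_{m+1}(A), p̄: W_m(A_f) → W_{m+1}(A_f), and the two localization maps W_m(A) → W_m(A_f), W_{m+1}(A) → W_{m+1}(A_f) is Cartesian; that is, if x ∈ W_m(A_f) satisfies p̄(x) ∈ image(W_{m+1}(A) → W_{m+1}(A_f)), then x ∈ image(W_m(A) → W_m(A_f)). -/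
theorem twvR_coeff {p : ℕ} [Fact p.Prime] {B : Type*} [CommRing B] {m : ℕ}
    (y : TruncatedWittVector p (m + 1) B) (i : Fin m) :
    (twvR p y).coeff i = y.coeff i.castSucc :=
  TruncatedWittVector.coeff_truncate (Nat.le_succ m) i y

theorem twvR_surjective {p : ℕ} [Fact p.Prime] {B : Type*} [CommRing B] {m : ℕ} :
    Function.Surjective (twvR p : TruncatedWittVector p (m + 1) B →+* _) :=
  TruncatedWittVector.truncate_surjective (Nat.le_succ m)

/-- In characteristic `p`, multiplication by `p` on truncated Witt vectors is `V ∘ F`. -/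
theorem twv_nsmul_eq_twvV_twvF {p : ℕ} [Fact p.Prime] {B : Type*} [CommRing B] [CharP B p] {m : ℕ}
    (y : TruncatedWittVector p (m + 1) B) : p • y = twvV p (twvF p y) := by
  obtain ⟨w, rfl⟩ := WittVector.truncate_surjective p (m + 1) B y
  rw [← map_nsmul, nsmul_eq_mul, mul_comm]
  ext i
  rw [WittVector.coeff_truncate]
  refine Fin.cases ?_ (fun j => ?_) i
  · simp [twvV, WittVector.mul_charP_coeff_zero]
  · simp [twvV, twvF, WittVector.mul_charP_coeff_succ]

/-- In characteristic `p`, multiplication by `p` on `W_{m+1}(B)` factors uniquely through `R`. -/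
theorem existsUnique_twv_pbar (p : ℕ) [Fact p.Prime] (B : Type*) [CommRing B] [CharP B p] (m : ℕ) :
    ∃! pbar : TruncatedWittVector p m B →+ TruncatedWittVector p (m + 1) B,
      ∀ y, pbar (twvR p y) = p • y := by
  have hker : (twvR p : TruncatedWittVector p (m + 1) B →+* _).toAddMonoidHom.ker ≤
      (nsmulAddMonoidHom p : TruncatedWittVector p (m + 1) B →+ _).ker := by
    intro y hy
    have hF : twvF p y = 0 := by
      ext i
      have hR : twvR p y = 0 := hy
      have hi : y.coeff i.castSucc = 0 := by rw [← twvR_coeff, hR, TruncatedWittVector.coeff_zero]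
      simp [twvF, hi, (Fact.out : p.Prime).ne_zero]
    change p • y = 0
    rw [twv_nsmul_eq_twvV_twvF, hF]
    ext i
    refine Fin.cases ?_ (fun j => ?_) i <;> simp [twvV]
  let g := AddMonoidHom.liftOfSurjective
    (twvR p : TruncatedWittVector p (m + 1) B →+* _).toAddMonoidHom twvR_surjective
    ⟨nsmulAddMonoidHom p, hker⟩
  have hg : ∀ y, g (twvR p y) = p • y := fun y =>
    AddMonoidHom.liftOfRightInverse_comp_apply _ _ _ ⟨nsmulAddMonoidHom p, hker⟩ y
  refine ⟨g, hg, fun g' hg' => ?_⟩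
  ext1 x
  obtain ⟨y, rfl⟩ := twvR_surjective x
  rw [hg', hg]

/-- An element of a localization of an integrally closed domain lies in the domain as soon as a
positive power of it does. -/
theorem IsLocalization.mem_range_algebraMap_of_pow_mem_range {A : Type*} [CommRing A] [IsDomain A]
    [IsIntegrallyClosed A] {M : Submonoid A} (hM : M ≤ nonZeroDivisors A) {S : Type*} [CommRing S]
    [Algebra A S] [IsLocalization M S] {n : ℕ} (hn : n ≠ 0) {a : S}
    (ha : a ^ n ∈ Set.range (algebraMap A S)) : a ∈ Set.range (algebraMap A S) := by
  obtain ⟨b, hb⟩ := ha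
  obtain ⟨⟨c, s⟩, hc⟩ := IsLocalization.surj M a
  have hdvd : (s : A) ^ n ∣ c ^ n := by
    refine ⟨b, IsLocalization.injective S hM ?_⟩
    simp only [map_pow, map_mul, hb, ← hc]
    ring
  obtain ⟨d, rfl⟩ := (IsIntegrallyClosed.pow_dvd_pow_iff hn).1 hdvd
  refine ⟨d, (IsLocalization.map_units S s).mul_right_cancel ?_⟩
  rw [hc, ← map_mul, mul_comm]

/-- Let `A` be a normal (integrally closed) Noetherian domain of
characteristic `p > 0` (e.g. a regular domain essentially of finite type over a perfect field of
characteristic `p`).  Let `f ∈ A` be nonzero and `A_f = A[1/f]`.  Let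
`p̄ : W_m(A_f) → W_{m+1}(A_f)` be the unique additive map with `p̄ ∘ R = p·(−)` (and similarly
for `A`).  Then the square formed by `p̄ : W_m(A) → W_{m+1}(A)`,
`p̄ : W_m(A_f) → W_{m+1}(A_f)` and the two localization maps is Cartesian: if `x ∈ W_m(A_f)`
satisfies `p̄(x) ∈ image (W_{m+1}(A) → W_{m+1}(A_f))`, then
`x ∈ image (W_m(A) → W_m(A_f))`. -/
theorem twistedWitt_pbar_cartesian
    (p : ℕ) [Fact p.Prime] (A : Type*) [CommRing A] [IsDomain A] [IsNoetherianRing A]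
    [IsIntegrallyClosed A] [CharP A p] (f : A) (hf : f ≠ 0) (m : ℕ) (hm : 1 ≤ m) :
    (∃! pbarA : TruncatedWittVector p m A →+ TruncatedWittVector p (m + 1) A,
      ∀ y, pbarA (twvR p y) = p • y) ∧
    (∃! pbar : TruncatedWittVector p m (Localization.Away f) →+
        TruncatedWittVector p (m + 1) (Localization.Away f),
      ∀ y, pbar (twvR p y) = p • y) ∧
    (∀ pbar : TruncatedWittVector p m (Localization.Away f) →+
        TruncatedWittVector p (m + 1) (Localization.Away f),
      (∀ y, pbar (twvR p y) = p • y) →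
        ∀ x : TruncatedWittVector p m (Localization.Away f),
          pbar x ∈ Set.range (twvLoc p A f (m + 1)) → x ∈ Set.range (twvLoc p A f m)) := by
  have hM : Submonoid.powers f ≤ nonZeroDivisors A := powers_le_nonZeroDivisors_of_noZeroDivisors hf
  have hchar : CharP (Localization.Away f) p :=
    charP_of_injective_algebraMap (IsLocalization.injective _ hM) p
  refine ⟨existsUnique_twv_pbar p A m, existsUnique_twv_pbar p (Localization.Away f) m, ?_⟩
  rintro pbar hpbar x ⟨z, hz⟩
  obtain ⟨y, rfl⟩ := twvR_surjective x
  rw [hpbar, twv_nsmul_eq_twvV_twvF] at hz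
  have hcoeff (i : Fin m) :
      (twvR p y).coeff i ∈ Set.range (algebraMap A (Localization.Away f)) := by
    refine IsLocalization.mem_range_algebraMap_of_pow_mem_range hM
      (Fact.out : p.Prime).ne_zero ⟨z.coeff i.succ, ?_⟩
    have hi := congrArg (TruncatedWittVector.coeff i.succ) hz
    simpa [twvLoc, twvMap, twvV, twvF, twvR_coeff] using hi
  choose c hc using hcoeff
  refine ⟨TruncatedWittVector.mk p c, ?_⟩
  ext i
  simp [twvLoc, twvMap, hc]
end
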